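/- Let k be an infinite field, n ≥ 2, and I an ideal of k[x₁,...,xₙ] such that I ∩ k[x₁] = {0}. Then there exists a ∈ k such that the image ideal ev_a(I) is a proper ideal of k[x₂,...,xₙ]. -/

import Mathlib

open MvPolynomial

/-- The evaluation homomorphism `ev_a : k[x₁,…,xₙ] → k[x₂,…,xₙ]`, `x₁ ↦ a`,
`xᵢ ↦ xᵢ₋₁` for `i ≥ 2`. -/
noncomputable def evalAt {k : Type*} [CommSemiring k] {n : ℕ} (a : k) :
    MvPolynomial (Fin (n + 1)) k →ₐ[k] MvPolynomial (Fin n) k :=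
  aeval (Fin.cases (C a) X)

/-- The canonical embedding `k[x₁] → k[x₁,…,xₙ]`. -/
noncomputable def univEmb (k : Type*) [CommSemiring k] (n : ℕ) :
    Polynomial k →ₐ[k] MvPolynomial (Fin (n + 1)) k :=
  Polynomial.aeval (X 0)

/-- A constructible subset of the spectrum of a domain containing the generic point contains
a nonempty basic open set. -/
lemma PrimeSpectrum.exists_basicOpen_subset_of_isConstructible {R : Type*} [CommRing R]
    [IsDomain R] {s : Set (PrimeSpectrum R)} (hs : Topology.IsConstructible s) (hbot : ⊥ ∈ s) :
    ∃ f : R, f ≠ 0 ∧ (PrimeSpectrum.basicOpen f : Set (PrimeSpectrum R)) ⊆ s := by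
  obtain ⟨S, rfl⟩ := PrimeSpectrum.exists_constructibleSetData_iff.mpr hs
  obtain ⟨D, hD, hg, hf⟩ := Set.mem_iUnion₂.mp hbot
  refine ⟨D.f, fun h => hf ?_, fun p hp => Set.mem_iUnion₂.mpr ⟨D, hD, ?_, ?_⟩⟩
  · simp [h]
  · rintro _ ⟨i, rfl⟩
    have h0 : D.g i = 0 := hg ⟨i, rfl⟩
    simp [h0]
  · simpa using hp

lemma univEmb_finitePresentation (k : Type*) [Field k] (n : ℕ) :
    (univEmb k n).toRingHom.FinitePresentation := by
  refine RingHom.FinitePresentation.of_finiteType.mp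
    (RingHom.FiniteType.of_comp_finiteType (f := algebraMap k (Polynomial k)) ?_)
  have h : (univEmb k n).toRingHom.comp (algebraMap k (Polynomial k)) =
      algebraMap k (MvPolynomial (Fin (n + 1)) k) := (univEmb k n).comp_algebraMap
  rw [h, RingHom.finiteType_algebraMap]
  infer_instance

/-- If a prime `Q ⊇ I` contains `x₁ - a`, then `ev_a(I)` is proper. -/
lemma map_evalAt_ne_top {k : Type*} [Field k] {n : ℕ} {a : k}
    {I Q : Ideal (MvPolynomial (Fin (n + 1)) k)} (hQ : Q ≠ ⊤) (hIQ : I ≤ Q)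
    (ha : X 0 - C a ∈ Q) : Ideal.map (evalAt a) I ≠ ⊤ := by
  let ψ : MvPolynomial (Fin n) k →ₐ[k] MvPolynomial (Fin (n + 1)) k ⧸ Q :=
    (Ideal.Quotient.mkₐ k Q).comp (rename Fin.succ)
  have hψ : ψ.comp (evalAt a) = Ideal.Quotient.mkₐ k Q := by
    refine MvPolynomial.algHom_ext fun i => ?_
    refine Fin.cases ?_ (fun j => ?_) i
    · simpa [ψ, evalAt] using (Ideal.Quotient.eq.mpr ha).symm
    · simp [ψ, evalAt]
  have hle : Ideal.map (evalAt a) I ≤ RingHom.ker ψ := by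
    refine Ideal.map_le_iff_le_comap.mpr fun p hp => ?_
    have h : ψ (evalAt a p) = Ideal.Quotient.mk Q p := DFunLike.congr_fun hψ p
    rw [Ideal.mem_comap, RingHom.mem_ker, h]
    exact Ideal.Quotient.eq_zero_iff_mem.mpr (hIQ hp)
  have : Nontrivial (MvPolynomial (Fin (n + 1)) k ⧸ Q) := Ideal.Quotient.nontrivial_iff.mpr hQ
  exact fun h => RingHom.ker_ne_top ψ (top_le_iff.mp (h ▸ hle))

/-- Corollary: over an infinite field `k`, if `I ∩ k[x₁] = {0}` then `ev_a(I)` is a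
proper ideal of `k[x₂,…,xₙ]` for some `a ∈ k`.
(Here the ambient ring has `n + 2 ≥ 2` variables.) -/
theorem cor_base {k : Type*} [Field k] [Infinite k] (n : ℕ)
    (I : Ideal (MvPolynomial (Fin (n + 2)) k))
    (hI : Ideal.comap (univEmb k (n + 1)) I = ⊥) :
    ∃ a : k, Ideal.map (evalAt a) I ≠ ⊤ := by
  let φ := (univEmb k (n + 1)).toRingHom
  have hI' : I.comap φ = ⊥ := hI
  have hZ : Topology.IsConstructible
      (PrimeSpectrum.zeroLocus (I : Set (MvPolynomial (Fin (n + 2)) k))) := by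
    obtain ⟨s, rfl⟩ := IsNoetherian.noetherian I
    rw [← Topology.isConstructible_compl, PrimeSpectrum.zeroLocus_span]
    exact (PrimeSpectrum.isRetrocompact_zeroLocus_compl s.finite_toSet).isConstructible
      (PrimeSpectrum.isClosed_zeroLocus _).isOpen_compl
  have hbot : ⊥ ∈ PrimeSpectrum.comap φ ''
      PrimeSpectrum.zeroLocus (I : Set (MvPolynomial (Fin (n + 2)) k)) := by
    obtain ⟨P, hP, hIP, hPbot⟩ := Ideal.exists_comap_eq_of_mem_minimalPrimes (I := I) φ ⊥ (by
      rw [hI', Ideal.minimalPrimes_eq_subsingleton_self]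
      rfl)
    exact ⟨⟨P, hP⟩, hIP, PrimeSpectrum.ext hPbot⟩
  obtain ⟨f, hf, hsub⟩ := PrimeSpectrum.exists_basicOpen_subset_of_isConstructible
    (PrimeSpectrum.isConstructible_comap_image (univEmb_finitePresentation k (n + 1)) hZ) hbot
  obtain ⟨a, ha⟩ : ∃ a, f.eval a ≠ 0 := by
    by_contra! h
    exact hf (Polynomial.funext fun a => by simp [h a])
  have hprime : (RingHom.ker (Polynomial.evalRingHom a)).IsPrime := RingHom.ker_isPrime _
  obtain ⟨Q, hIQ, hQ⟩ := @hsub ⟨_, hprime⟩ ha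
  refine ⟨a, map_evalAt_ne_top Q.isPrime.ne_top hIQ ?_⟩
  have hmem : Polynomial.X - Polynomial.C a ∈ (PrimeSpectrum.comap φ Q).asIdeal := by
    rw [hQ]
    simp [RingHom.mem_ker]
  simpa [φ, univEmb, MvPolynomial.algebraMap_eq] using hmem
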